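/- arXiv:math/0101018 — 3 statements merged into one kernel-verified Lean document; each statement's English description precedes it below -/
import Mathlib

section
/- Fix an integer l ≥ 1. For every polynomial P ∈ ℂ[u] with constant term P(0) = 1, there exist unique polynomials P⁰, P¹ ∈ ℂ[u], both with constant term 1, such that P(u) = P⁰(u)·P¹(u), the polynomial P⁰ is l-acyclic (i.e. P⁰ is not divisible by 1 − a·u^l for any nonzero a ∈ ℂ), and P¹(u) = R(u^l) for some polynomial R ∈ ℂ[u]. -/
open Polynomial

/-- A polynomial `P` is acyclic of level `l` if no `1 - a·u^l` with `a ≠ 0` divides it. -/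
def IsAcyclicOfLevel (l : ℕ) (P : ℂ[X]) : Prop :=
  ∀ a : ℂ, a ≠ 0 → ¬ ((1 - C a * X ^ l) ∣ P)

lemma one_sub_C_inv_mul_X_pow_dvd_expand {l : ℕ} {R : ℂ[X]} {b : ℂ} (hb : b ≠ 0)
    (h : R.IsRoot b) : (1 - C b⁻¹ * X ^ l) ∣ expand ℂ l R := by
  have h₁ : (X ^ l - C b : ℂ[X]) ∣ expand ℂ l R := by
    simpa using map_dvd (expand ℂ l) (dvd_iff_isRoot.mpr h)
  refine dvd_trans ⟨-C b, ?_⟩ h₁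
  have hC : (C b⁻¹ * C b : ℂ[X]) = 1 := by rw [← C_mul, inv_mul_cancel₀ hb, C_1]
  linear_combination (-X ^ l : ℂ[X]) * hC

/-- If `R(u^l)` divides an acyclic polynomial and `R(0) ≠ 0`, then `R` is constant. -/
lemma IsAcyclicOfLevel.isUnit_of_expand_dvd {l : ℕ} {Q R : ℂ[X]} (hQ : IsAcyclicOfLevel l Q)
    (hR : R.eval 0 ≠ 0) (h : expand ℂ l R ∣ Q) : IsUnit R := by
  have hR0 : R ≠ 0 := by
    rintro rfl
    simp at hR
  by_contra hu
  obtain ⟨b, hb⟩ := Complex.exists_root (degree_pos_of_ne_zero_of_nonunit hR0 hu)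
  have hb0 : b ≠ 0 := by
    rintro rfl
    exact hR hb
  exact hQ b⁻¹ (inv_ne_zero hb0) ((one_sub_C_inv_mul_X_pow_dvd_expand hb0 hb).trans h)

lemma IsAcyclicOfLevel.dvd_of_expand_dvd_mul {l : ℕ} (hl : 1 ≤ l) {Q R S : ℂ[X]}
    (hQ : IsAcyclicOfLevel l Q) (hR : R.eval 0 ≠ 0)
    (h : expand ℂ l R ∣ Q * expand ℂ l S) : R ∣ S := by
  have hR0 : R ≠ 0 := by
    rintro rfl
    simp at hR
  have hg0 : EuclideanDomain.gcd R S ≠ 0 := fun h0 => hR0 (EuclideanDomain.gcd_eq_zero_iff.mp h0).1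
  obtain ⟨r, hr⟩ := EuclideanDomain.gcd_dvd_left R S
  obtain ⟨s, hs⟩ := EuclideanDomain.gcd_dvd_right R S
  have hco : IsCoprime r s := by
    rw [← EuclideanDomain.gcd_isUnit_iff]
    have hd : EuclideanDomain.gcd R S * EuclideanDomain.gcd r s ∣ EuclideanDomain.gcd R S * 1 := by
      rw [mul_one]
      refine EuclideanDomain.dvd_gcd ?_ ?_
      · conv_rhs => rw [hr]
        exact mul_dvd_mul_left _ (EuclideanDomain.gcd_dvd_left r s)
      · conv_rhs => rw [hs]
        exact mul_dvd_mul_left _ (EuclideanDomain.gcd_dvd_right r s)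
    exact isUnit_of_dvd_one ((mul_dvd_mul_iff_left hg0).mp hd)
  generalize EuclideanDomain.gcd R S = g at hr hs hg0
  subst hr hs
  have hexp : expand ℂ l r ∣ Q := by
    rw [map_mul, map_mul, mul_left_comm,
      mul_dvd_mul_iff_left ((expand_ne_zero hl).mpr hg0)] at h
    exact (hco.map (expand ℂ l).toRingHom).dvd_of_dvd_mul_right h
  have hr : r.eval 0 ≠ 0 := by
    rw [eval_mul] at hR
    exact right_ne_zero_of_mul hR
  exact mul_dvd_mul_left g (hQ.isUnit_of_expand_dvd hr hexp).dvd

lemma eq_of_dvd_of_dvd_of_eval_eq_one {R S : ℂ[X]} {x : ℂ} (h₁ : R ∣ S) (h₂ : S ∣ R)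
    (hR : R.eval x = 1) (hS : S.eval x = 1) : R = S := by
  obtain ⟨u, rfl⟩ := associated_of_dvd_dvd h₁ h₂
  obtain ⟨c, -, hc⟩ := isUnit_iff.mp u.isUnit
  rw [← hc, eval_mul, hR, eval_C, one_mul] at hS
  rw [← hc, hS, C_1, mul_one]

lemma exists_isAcyclicOfLevel_mul_expand {l : ℕ} (hl : 1 ≤ l) (P : ℂ[X]) (hP : P.eval 0 = 1) :
    ∃ Q R : ℂ[X], Q.eval 0 = 1 ∧ R.eval 0 = 1 ∧ P = Q * expand ℂ l R ∧
      IsAcyclicOfLevel l Q := by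
  induction hn : P.natDegree using Nat.strong_induction_on generalizing P with
  | _ n ih =>
  by_cases hac : IsAcyclicOfLevel l P
  · exact ⟨P, 1, hP, by simp, by simp, hac⟩
  · simp only [IsAcyclicOfLevel, not_forall, not_not] at hac
    obtain ⟨a, ha, T, rfl⟩ := hac
    have hl0 : l ≠ 0 := by omega
    have hT : T.eval 0 = 1 := by simpa [hl0] using hP
    have hT0 : T ≠ 0 := by
      rintro rfl
      simp at hT
    have hdeg : (1 - C a * X ^ l : ℂ[X]).natDegree = l := by
      rw [natDegree_sub_eq_right_of_natDegree_lt] <;>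
        rw [natDegree_C_mul_X_pow l a ha]
      rwa [natDegree_one]
    have hF0 : (1 - C a * X ^ l : ℂ[X]) ≠ 0 := by
      intro h0
      rw [h0, natDegree_zero] at hdeg
      omega
    rw [natDegree_mul hF0 hT0, hdeg] at hn
    obtain ⟨Q, R, hQ, hR, rfl, hac⟩ := ih _ (by omega) T hT rfl
    refine ⟨Q, (1 - C a * X) * R, hQ, by simp [hR], ?_, hac⟩
    simp only [map_mul, map_sub, map_one, expand_C, expand_X]
    ring

/-- For `l ≥ 1` and `P ∈ ℂ[u]` with `P(0) = 1`, there exist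
unique polynomials `P⁰, P¹` with constant term `1` such that `P = P⁰ · P¹`,
`P⁰` is `l`-acyclic (not divisible by `1 - a·u^l` for any `a ≠ 0`), and
`P¹(u) = R(u^l)` for some polynomial `R`. -/
theorem stmt_3 (l : ℕ) (hl : 1 ≤ l) (P : ℂ[X]) (hP : P.eval 0 = 1) :
    ∃! PP : ℂ[X] × ℂ[X],
      PP.1.eval 0 = 1 ∧ PP.2.eval 0 = 1 ∧ P = PP.1 * PP.2 ∧
      (∀ a : ℂ, a ≠ 0 → ¬ ((1 - C a * X ^ l) ∣ PP.1)) ∧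
      (∃ R : ℂ[X], PP.2 = R.comp (X ^ l)) := by
  have hl0 : l ≠ 0 := by omega
  have heval (R : ℂ[X]) : (expand ℂ l R).eval 0 = R.eval 0 := by
    rw [expand_eval, zero_pow hl0]
  obtain ⟨Q, R, hQ, hR, hPQ, hac⟩ := exists_isAcyclicOfLevel_mul_expand hl P hP
  refine ⟨(Q, expand ℂ l R), ⟨hQ, by rw [heval, hR], hPQ, hac, R, expand_eq_comp_X_pow l⟩, ?_⟩
  rintro ⟨Q', S'⟩ ⟨-, hS, hPQ', hac', S, rfl⟩
  simp only [← expand_eq_comp_X_pow] at hS hPQ' ⊢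
  rw [heval] at hS
  have hRS : R = S := eq_of_dvd_of_dvd_of_eval_eq_one
    (IsAcyclicOfLevel.dvd_of_expand_dvd_mul hl hac' (by simp [hR])
      (hPQ' ▸ hPQ ▸ dvd_mul_left _ _))
    (hac.dvd_of_expand_dvd_mul hl (by simp [hS]) (hPQ ▸ hPQ' ▸ dvd_mul_left _ _)) hR hS
  subst hRS
  have hR0 : R ≠ 0 := by
    rintro rfl
    simp at hR
  rw [mul_right_cancel₀ ((expand_ne_zero hl).mpr hR0) (hPQ'.symm.trans hPQ)]
end

section
/- Let l ≥ 1 and let ε ∈ ℂ be nonzero with ε² a primitive l-th root of unity. Let P₁, P₂ ∈ ℂ[u] be polynomials with constant terms P₁(0) = P₂(0) = 1 satisfying the identity ∏_{j=0}^{l−1} P₁(ε^{2j}·u) = ∏_{j=0}^{l−1} P₂(ε^{2j}·u) in ℂ[u]. Then there exists a unique l-acyclic polynomial Q ∈ ℂ[u] with constant term Q(0) = 1 such that P₁(u)·Q(ε·u) = P₂(u)·Q(ε⁻¹·u) in ℂ[u], i.e. P₁(u)/P₂(u) = Q(u·ε⁻¹)/Q(u·ε) as rational functions. -/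
open Polynomial

section Acyclic

variable {K : Type*} [Field K]

/-- A nonzero root `c` of `P` splits off the factor `1 - c⁻¹ u`. -/
theorem exists_eq_one_sub_mul_of_isRoot {P : K[X]} {c : K} (hP : P.eval 0 = 1)
    (hc : P.IsRoot c) :
    ∃ P' : K[X], P = (1 - C c⁻¹ * X) * P' ∧ P'.eval 0 = 1 ∧ P'.natDegree < P.natDegree := by
  have hc0 : c ≠ 0 := by
    rintro rfl
    simp [IsRoot.def, hP] at hc
  obtain ⟨S, hS⟩ := dvd_iff_isRoot.2 hc
  have hS0 : S ≠ 0 := by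
    rintro rfl
    simp [hS] at hP
  have hP' : P = (1 - C c⁻¹ * X) * (C (-c) * S) := by
    have hcc : (C c⁻¹ * C c : K[X]) = 1 := by rw [← C_mul, inv_mul_cancel₀ hc0, C_1]
    rw [hS, C_neg]
    linear_combination (-X * S) * hcc
  refine ⟨C (-c) * S, hP', ?_, ?_⟩
  · simpa [hP'] using hP
  · rw [natDegree_C_mul (neg_ne_zero.2 hc0), hS, natDegree_mul (X_sub_C_ne_zero c) hS0,
      natDegree_X_sub_C]
    omega

theorem eq_one_of_isUnit_of_eval_zero {P : K[X]} (hP : IsUnit P) (h : P.eval 0 = 1) :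
    P = 1 := by
  obtain ⟨r, -, rfl⟩ := isUnit_iff.1 hP
  simp_all

theorem one_sub_ne_zero (a : K) : (1 - C a * X : K[X]) ≠ 0 := fun h => by
  simpa using congrArg (eval 0) h

/-- The product of `1 - α ζ^j u` over all powers of `ζ` depends only on the `ζ`-orbit of `α`. -/
theorem prod_one_sub_mul_pow {ζ : K} {l : ℕ} (hζ : ζ ^ l = 1) (α : K) (k : ℕ) :
    ∏ j ∈ Finset.range l, (1 - C (α * ζ ^ k * ζ ^ j) * X) =
      ∏ j ∈ Finset.range l, (1 - C (α * ζ ^ j) * X) := by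
  induction k with
  | zero => simp
  | succ k ih =>
    rw [← ih]
    have e := (Finset.prod_range_succ (fun j => 1 - C (α * ζ ^ k * ζ ^ j) * X) l).symm.trans
      (Finset.prod_range_succ' _ l)
    simp only [hζ, pow_zero] at e
    rw [mul_right_cancel₀ (one_sub_ne_zero _) e]
    exact Finset.prod_congr rfl fun j _ => by congr 3; ring

/-- Multiplicative form of Hilbert 90 for the substitution `u ↦ ζ u`, with `ζ = ε²`. -/
theorem exists_mul_comp_eq [IsAlgClosed K] {l : ℕ} (hl : 0 < l) {ε : K} (hε0 : ε ≠ 0)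
    (hε : (ε ^ 2) ^ l = 1) (P₁ P₂ : K[X]) (h₁ : P₁.eval 0 = 1) (h₂ : P₂.eval 0 = 1)
    (h : ∏ j ∈ Finset.range l, P₁.comp (C ((ε ^ 2) ^ j) * X) =
      ∏ j ∈ Finset.range l, P₂.comp (C ((ε ^ 2) ^ j) * X)) :
    ∃ Q : K[X], Q.eval 0 = 1 ∧ P₁ * Q.comp (C ε * X) = P₂ * Q.comp (C ε⁻¹ * X) := by
  induction hn : P₂.natDegree using Nat.strong_induction_on generalizing P₁ P₂ with
  | _ n ih =>
  by_cases hd : P₂.degree = 0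
  · have hP₂ : P₂ = 1 := eq_one_of_isUnit_of_eval_zero (isUnit_iff_degree_eq_zero.2 hd) h₂
    have hP₁ : P₁ = 1 := by
      refine eq_one_of_isUnit_of_eval_zero (isUnit_of_dvd_one ?_) h₁
      have hd₁ := Finset.dvd_prod_of_mem (fun j => P₁.comp (C ((ε ^ 2) ^ j) * X))
        (Finset.mem_range.2 hl)
      rw [h, hP₂] at hd₁
      simpa using hd₁
    exact ⟨1, by simp, by simp [hP₁, hP₂]⟩
  · obtain ⟨c, hc⟩ := IsAlgClosed.exists_root P₂ hd
    obtain ⟨j, hj, hjc⟩ : ∃ j ∈ Finset.range l, P₁.IsRoot ((ε ^ 2) ^ j * c) := by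
      have e := congrArg (eval c) h
      rw [eval_prod, eval_prod, Finset.prod_eq_zero (i := 0) (s := Finset.range l)
        (f := fun j => eval c (P₂.comp (C ((ε ^ 2) ^ j) * X))) (Finset.mem_range.2 hl)
        (by simpa using hc), Finset.prod_eq_zero_iff] at e
      simpa [IsRoot.def] using e
    obtain ⟨R₂, hR₂, hR₂0, hdeg⟩ := exists_eq_one_sub_mul_of_isRoot h₂ hc
    obtain ⟨R₁, hR₁, hR₁0, -⟩ := exists_eq_one_sub_mul_of_isRoot h₁ hjc
    set β := ((ε ^ 2) ^ j * c)⁻¹ with hβ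
    have hcβ : c⁻¹ = β * (ε ^ 2) ^ j := by
      rw [hβ, mul_inv, mul_right_comm, inv_mul_cancel₀ (pow_ne_zero _ (pow_ne_zero _ hε0)),
        one_mul]
    rw [hcβ] at hR₂
    have hlin (a : K) : ∏ i ∈ Finset.range l, (1 - C a * X).comp (C ((ε ^ 2) ^ i) * X) =
        ∏ i ∈ Finset.range l, (1 - C (a * (ε ^ 2) ^ i) * X) :=
      Finset.prod_congr rfl fun i _ => by simp [mul_assoc]
    obtain ⟨Q, hQ0, hQ⟩ := ih _ (hn ▸ hdeg) R₁ R₂ hR₁0 hR₂0 (by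
      rw [hR₁, hR₂] at h
      simp only [mul_comp, Finset.prod_mul_distrib] at h
      rw [hlin, hlin, prod_one_sub_mul_pow hε] at h
      exact mul_left_cancel₀ (Finset.prod_ne_zero_iff.2 fun i _ => one_sub_ne_zero _) h) rfl
    refine ⟨(∏ i ∈ Finset.range j, (1 - C (β * (ε ^ 2) ^ i * ε) * X)) * Q, ?_, ?_⟩
    · simp [eval_prod, hQ0]
    · have hA : (∏ i ∈ Finset.range j, (1 - C (β * (ε ^ 2) ^ i * ε) * X)).comp (C ε * X) =
          ∏ i ∈ Finset.range j, (1 - C (β * (ε ^ 2) ^ (i + 1)) * X) := by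
        rw [prod_comp]
        refine Finset.prod_congr rfl fun i _ => ?_
        simp only [sub_comp, one_comp, mul_comp, C_comp, X_comp, ← mul_assoc, ← C_mul]
        congr 3; ring
      have hB : (∏ i ∈ Finset.range j, (1 - C (β * (ε ^ 2) ^ i * ε) * X)).comp (C ε⁻¹ * X) =
          ∏ i ∈ Finset.range j, (1 - C (β * (ε ^ 2) ^ i) * X) := by
        rw [prod_comp]
        refine Finset.prod_congr rfl fun i _ => ?_
        simp only [sub_comp, one_comp, mul_comp, C_comp, X_comp, ← mul_assoc, ← C_mul]
        congr 3; field_simp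
      have e := (Finset.prod_range_succ (fun i => 1 - C (β * (ε ^ 2) ^ i) * X) j).symm.trans
        (Finset.prod_range_succ' _ j)
      rw [pow_zero, mul_one] at e
      rw [mul_comp, mul_comp, hA, hB, hR₁, hR₂]
      linear_combination
        (∏ i ∈ Finset.range j, (1 - C (β * (ε ^ 2) ^ (i + 1)) * X)) * (1 - C β * X) * hQ
        - R₂ * Q.comp (C ε⁻¹ * X) * e

/-- Removing factors `1 - a u^l` turns a solution of the functional equation into an acyclic one. -/
theorem exists_acyclic_mul_comp_eq {l : ℕ} (hl : 0 < l) {ε : K}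
    (hε : (ε ^ 2) ^ l = 1) {P₁ P₂ Q : K[X]} (hQ0 : Q.eval 0 = 1)
    (hQ : P₁ * Q.comp (C ε * X) = P₂ * Q.comp (C ε⁻¹ * X)) :
    ∃ Q : K[X], Q.eval 0 = 1 ∧ (∀ a : K, a ≠ 0 → ¬ ((1 - C a * X ^ l) ∣ Q)) ∧
      P₁ * Q.comp (C ε * X) = P₂ * Q.comp (C ε⁻¹ * X) := by
  induction hn : Q.natDegree using Nat.strong_induction_on generalizing Q with
  | _ n ih =>
  by_cases hac : ∀ a : K, a ≠ 0 → ¬ ((1 - C a * X ^ l) ∣ Q)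
  · exact ⟨Q, hQ0, hac, hQ⟩
  push Not at hac
  obtain ⟨a, ha, S, hS⟩ := hac
  have hεl : ε⁻¹ ^ l = ε ^ l := by
    rw [inv_pow, inv_eq_iff_eq_inv]
    exact eq_inv_of_mul_eq_one_left (by rw [← mul_pow, ← sq, hε])
  have hS0 : S.eval 0 = 1 := by simpa [hS, hl.ne'] using hQ0
  have hdeg : (1 - C a * X ^ l : K[X]).natDegree = l := by
    rw [natDegree_sub_eq_right_of_natDegree_lt] <;> simp [natDegree_C_mul_X_pow l a ha, hl]
  refine ih S.natDegree ?_ hS0 ?_ rfl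
  · rw [← hn, hS, natDegree_mul, hdeg]
    · omega
    · rintro h; simp [h, hl.ne] at hdeg
    · rintro rfl; simp at hS0
  · have hcomp (b : K) : (1 - C a * X ^ l).comp (C b * X) = 1 - C (a * b ^ l) * X ^ l := by
      simp [mul_pow, mul_assoc]
    rw [hS, mul_comp, mul_comp, hcomp, hcomp, hεl] at hQ
    refine mul_left_cancel₀ (a := 1 - C (a * ε ^ l) * X ^ l) (fun h => ?_) ?_
    · simpa [hl.ne'] using congrArg (eval 0) h
    · linear_combination hQ

/-- A polynomial invariant under `u ↦ ζ u` with a nonzero root has a factor `1 - a u^l`. -/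
theorem exists_one_sub_dvd_of_isRoot {l : ℕ} (hl : 0 < l) {ζ : K}
    (hζ : IsPrimitiveRoot ζ l) {r : K[X]} (hr : r.comp (C ζ * X) = r) {c : K} (hc0 : c ≠ 0)
    (hc : r.IsRoot c) : ∃ a : K, a ≠ 0 ∧ (1 - C a * X ^ l) ∣ r := by
  have hroot (i : ℕ) : r.IsRoot (ζ ^ i * c) := by
    induction i with
    | zero => simpa using hc
    | succ i ih =>
      rw [← hr] at ih
      simpa [IsRoot.def, pow_succ', mul_assoc] using ih
  have hdvd : X ^ l - C (c ^ l) ∣ r := by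
    rw [X_pow_sub_C_eq_prod hζ hl rfl]
    refine Finset.prod_dvd_of_coprime (fun i hi j hj hij => ?_)
      fun i _ => dvd_iff_isRoot.2 (hroot i)
    refine isCoprime_X_sub_C_of_isUnit_sub (sub_ne_zero.2 fun e => hij ?_).isUnit
    exact hζ.pow_inj (Finset.mem_range.1 hi) (Finset.mem_range.1 hj) (mul_right_cancel₀ hc0 e)
  refine ⟨(c ^ l)⁻¹, inv_ne_zero (pow_ne_zero _ hc0), ?_⟩
  have e : X ^ l - C (c ^ l) = C (-c ^ l) * (1 - C (c ^ l)⁻¹ * X ^ l) := by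
    have hcc : (C (c ^ l) * C (c ^ l)⁻¹ : K[X]) = 1 := by
      rw [← C_mul, mul_inv_cancel₀ (pow_ne_zero _ hc0), C_1]
    rw [C_neg]
    linear_combination (-X ^ l) * hcc
  exact (Dvd.intro_left _ e.symm).trans hdvd

/-- If `q(ζu) r(u) = q(u) r(ζu)` with `q`, `r` coprime, then an acyclic `r` is a unit. -/
theorem isUnit_of_isCoprime_of_acyclic [IsAlgClosed K] {l : ℕ} (hl : 0 < l) {ζ : K}
    (hζ : IsPrimitiveRoot ζ l) {q r : K[X]} (hqr : IsCoprime q r) (hr0 : r.eval 0 ≠ 0)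
    (h : q.comp (C ζ * X) * r = q * r.comp (C ζ * X))
    (hac : ∀ a : K, a ≠ 0 → ¬ ((1 - C a * X ^ l) ∣ r)) : IsUnit r := by
  have hdeg : (r.comp (C ζ * X)).natDegree = r.natDegree := by
    rw [natDegree_comp, natDegree_C_mul_X _ (hζ.ne_zero hl.ne'), mul_one]
  obtain ⟨s, hs⟩ : r ∣ r.comp (C ζ * X) :=
    hqr.symm.dvd_of_dvd_mul_left (Dvd.intro_left _ h)
  have hs0 : s.eval 0 = 1 := by
    have e := congrArg (eval 0) hs
    simp only [eval_comp, eval_mul, eval_C, eval_X, mul_zero] at e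
    exact (mul_eq_left₀ hr0).1 e.symm
  have hr : r ≠ 0 := by rintro rfl; simp at hr0
  have hs1 : s = 1 := by
    have hsne : s ≠ 0 := by rintro rfl; simp at hs0
    rw [hs, natDegree_mul hr hsne] at hdeg
    refine eq_one_of_isUnit_of_eval_zero (isUnit_iff_degree_eq_zero.2 ?_) hs0
    rw [degree_eq_natDegree hsne]
    exact_mod_cast (by omega : s.natDegree = 0)
  rw [hs1, mul_one] at hs
  by_contra hu
  obtain ⟨c, hc⟩ := IsAlgClosed.exists_root r (fun hd => hu (isUnit_iff_degree_eq_zero.2 hd))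
  obtain ⟨a, ha, had⟩ := exists_one_sub_dvd_of_isRoot hl hζ hs
    (by rintro rfl; exact hr0 hc) hc
  exact hac a ha had

/-- Acyclic `Q`, `R` with `Q(0) = R(0) = 1` and `Q(ζu) R(u) = Q(u) R(ζu)` coincide. -/
theorem eq_of_acyclic_of_comp_mul_eq [IsAlgClosed K] {l : ℕ} (hl : 0 < l) {ζ : K}
    (hζ : IsPrimitiveRoot ζ l) {Q R : K[X]} (hQ0 : Q.eval 0 = 1) (hR0 : R.eval 0 = 1)
    (hQ : ∀ a : K, a ≠ 0 → ¬ ((1 - C a * X ^ l) ∣ Q))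
    (hR : ∀ a : K, a ≠ 0 → ¬ ((1 - C a * X ^ l) ∣ R))
    (h : Q.comp (C ζ * X) * R = Q * R.comp (C ζ * X)) : Q = R := by
  classical
  obtain ⟨G, q, r, hqr, rfl, rfl⟩ :
      ∃ G q r : K[X], IsCoprime q r ∧ Q = G * q ∧ R = G * r := by
    let := EuclideanDomain.gcdMonoid K[X]
    obtain ⟨q, r, hq, hr, hu⟩ := extract_gcd Q R
    exact ⟨gcd Q R, q, r, (gcd_isUnit_iff q r).1 hu, hq, hr⟩
  have hGne : G ≠ 0 := by rintro rfl; simp at hQ0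
  have hGc : G.comp (C ζ * X) ≠ 0 := fun e => by
    have := congrArg (eval 0) e
    simp at this
    simp [this] at hQ0
  have hq0 : q.eval 0 ≠ 0 := fun e => by simp [e] at hQ0
  have hr0 : r.eval 0 ≠ 0 := fun e => by simp [e] at hR0
  have hqreq : q.comp (C ζ * X) * r = q * r.comp (C ζ * X) := by
    refine mul_left_cancel₀ (mul_ne_zero hGne hGc) ?_
    simp only [mul_comp] at h
    linear_combination h
  have hr := isUnit_of_isCoprime_of_acyclic hl hζ hqr hr0 hqreq
    fun a ha hd => hR a ha (hd.mul_left G)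
  have hq := isUnit_of_isCoprime_of_acyclic hl hζ hqr.symm hq0
    (by linear_combination -hqreq) fun a ha hd => hQ a ha (hd.mul_left G)
  obtain ⟨x, -, rfl⟩ := isUnit_iff.1 hq
  obtain ⟨y, -, rfl⟩ := isUnit_iff.1 hr
  simp only [eval_mul, eval_C] at hQ0 hR0 hq0
  have hG0 : G.eval 0 ≠ 0 := fun e => by simp [e] at hQ0
  rw [mul_left_cancel₀ hG0 (hQ0.trans hR0.symm)]

end Acyclic

/-- Let `ε ≠ 0` with `ε²` a primitive `l`-th root of unity, and
`P₁, P₂ ∈ ℂ[u]` with constant term `1` such that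
`∏_{j=0}^{l-1} P₁(ε^{2j}·u) = ∏_{j=0}^{l-1} P₂(ε^{2j}·u)`. Then there is a
unique `l`-acyclic `Q` with `Q(0) = 1` such that
`P₁(u)·Q(ε·u) = P₂(u)·Q(ε⁻¹·u)`. -/
theorem stmt_7 (l : ℕ) (hl : 1 ≤ l) (ε : ℂ) (hε0 : ε ≠ 0)
    (hε : IsPrimitiveRoot (ε ^ 2) l)
    (P₁ P₂ : ℂ[X]) (h₁ : P₁.eval 0 = 1) (h₂ : P₂.eval 0 = 1)
    (h : ∏ j ∈ Finset.range l, P₁.comp (C (ε ^ (2 * j)) * X) =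
         ∏ j ∈ Finset.range l, P₂.comp (C (ε ^ (2 * j)) * X)) :
    ∃! Q : ℂ[X],
      Q.eval 0 = 1 ∧
      (∀ a : ℂ, a ≠ 0 → ¬ ((1 - C a * X ^ l) ∣ Q)) ∧
      P₁ * Q.comp (C ε * X) = P₂ * Q.comp (C ε⁻¹ * X) := by
  simp only [pow_mul] at h
  obtain ⟨Q₀, hQ₀, hQ₀'⟩ := exists_mul_comp_eq hl hε0 hε.pow_eq_one P₁ P₂ h₁ h₂ h
  obtain ⟨Q, hQ0, hQac, hQ⟩ := exists_acyclic_mul_comp_eq hl hε.pow_eq_one hQ₀ hQ₀'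
  refine ⟨Q, ⟨hQ0, hQac, hQ⟩, ?_⟩
  rintro R ⟨hR0, hRac, hR⟩
  refine eq_of_acyclic_of_comp_mul_eq hl hε hR0 hQ0 hRac hQac ?_
  have hP : P₁ * P₂ ≠ 0 := fun e => by simpa [h₁, h₂] using congrArg (eval 0) e
  have e : R.comp (C ε * X) * Q.comp (C ε⁻¹ * X) = R.comp (C ε⁻¹ * X) * Q.comp (C ε * X) := by
    refine mul_left_cancel₀ hP ?_
    linear_combination P₂ * Q.comp (C ε⁻¹ * X) * hR - P₂ * R.comp (C ε⁻¹ * X) * hQ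
  have e' := congrArg (fun p => p.comp (C ε * X)) e
  have hX : (C ε⁻¹ * (C ε * X) : ℂ[X]) = X := by
    rw [← mul_assoc, ← C_mul, inv_mul_cancel₀ hε0, C_1, one_mul]
  have hX' : (C ε * (C ε * X) : ℂ[X]) = C (ε ^ 2) * X := by
    rw [← mul_assoc, ← C_mul, sq]
  simpa only [mul_comp, comp_assoc, C_comp, X_comp, hX, hX', comp_X] using e'
end

section
/- Let l ≥ 1 and let ε ∈ ℂ be nonzero with ε² a primitive l-th root of unity. If Q₁, Q₂ ∈ ℂ[u] are l-acyclic polynomials with constant terms Q₁(0) = Q₂(0) = 1 satisfying Q₁(ε⁻¹·u)·Q₂(ε·u) = Q₁(ε·u)·Q₂(ε⁻¹·u) in ℂ[u] (i.e. Q₁(u·ε⁻¹)/Q₁(u·ε) = Q₂(u·ε⁻¹)/Q₂(u·ε) as rational functions), then Q₁ = Q₂. -/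
open Polynomial

/-- A polynomial with nonzero constant term that divides its own dilation equals it. -/
lemma comp_C_mul_X_eq_self_of_dvd {A : ℂ[X]} {q : ℂ} (hq : q ≠ 0) (hA : A.eval 0 ≠ 0)
    (hdvd : A ∣ A.comp (C q * X)) : A.comp (C q * X) = A := by
  obtain ⟨D, hD⟩ := hdvd
  have hA0 : A ≠ 0 := by
    rintro rfl
    simp at hA
  have hdeg : (A.comp (C q * X)).natDegree = A.natDegree := by
    rw [natDegree_comp, natDegree_C_mul_X q hq, mul_one]
  have heval : (A.comp (C q * X)).eval 0 = A.eval 0 := by simp [eval_comp]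
  rw [hD, eval_mul] at heval
  have hD1 : D.eval 0 = 1 := mul_left_cancel₀ hA (by rw [heval, mul_one])
  have hD0 : D ≠ 0 := by
    rintro rfl
    simp at hD1
  rw [hD, natDegree_mul hA0 hD0] at hdeg
  have hDC : D = C (D.coeff 0) := eq_C_of_natDegree_eq_zero (by omega)
  rw [coeff_zero_eq_eval_zero, hD1, C_1] at hDC
  rw [hD, hDC, mul_one]

/-- A polynomial invariant under dilation by a primitive `l`-th root of unity is a polynomial
in `X ^ l`. -/
lemma exists_expand_eq_of_comp_C_mul_X_eq {l : ℕ} (hl : l ≠ 0) {q : ℂ}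
    (hq : IsPrimitiveRoot q l) {A : ℂ[X]} (hA : A.comp (C q * X) = A) :
    ∃ B : ℂ[X], expand ℂ l B = A := by
  refine ⟨contract l A, ?_⟩
  ext n
  rw [coeff_expand (Nat.pos_of_ne_zero hl)]
  split_ifs with hn
  · rw [coeff_contract hl, Nat.div_mul_cancel hn]
  · have hc := congrArg (fun P : ℂ[X] => P.coeff n) hA
    simp only [comp_C_mul_X_coeff] at hc
    by_contra h0
    exact hn (hq.dvd_of_pow_eq_one n (mul_left_cancel₀ (Ne.symm h0) (by rw [hc, mul_one])))

/-- A polynomial with nonzero constant term, invariant under dilation by a primitive `l`-th root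
of unity and without factors `1 - a * X ^ l`, is constant. -/
lemma eq_C_of_comp_C_mul_X_eq {l : ℕ} (hl : l ≠ 0) {q : ℂ} (hq : IsPrimitiveRoot q l)
    {A : ℂ[X]} (hA0 : A.eval 0 ≠ 0) (hA : A.comp (C q * X) = A)
    (hac : ∀ a : ℂ, a ≠ 0 → ¬ ((1 - C a * X ^ l) ∣ A)) : A = C (A.eval 0) := by
  rw [← coeff_zero_eq_eval_zero]
  by_contra hne
  have hdeg : A.degree ≠ 0 := fun hd => hne (eq_C_of_degree_eq_zero hd)
  obtain ⟨r, hr⟩ := IsAlgClosed.exists_root A hdeg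
  have hr0 : r ≠ 0 := by
    rintro rfl
    exact hA0 hr
  have hrl : r ^ l ≠ 0 := pow_ne_zero l hr0
  obtain ⟨B, rfl⟩ := exists_expand_eq_of_comp_C_mul_X_eq hl hq hA
  have hB : X - C (r ^ l) ∣ B := by
    rw [dvd_iff_isRoot, IsRoot.def, ← expand_eval]
    exact hr
  have hdvd : X ^ l - C (r ^ l) ∣ expand ℂ l B := by
    simpa using map_dvd (expand ℂ l) hB
  refine hac (r ^ l)⁻¹ (inv_ne_zero hrl) (dvd_trans ⟨C (-(r ^ l)), ?_⟩ hdvd)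
  have hC : C (r ^ l)⁻¹ * C (r ^ l) = (1 : ℂ[X]) := by
    rw [← C_mul, inv_mul_cancel₀ hrl, C_1]
  rw [C_neg]
  linear_combination -X ^ l * hC

/-- Let `ε ≠ 0` with `ε²` a primitive `l`-th root of unity. If
`Q₁, Q₂` are `l`-acyclic polynomials with constant term `1` satisfying
`Q₁(ε⁻¹·u)·Q₂(ε·u) = Q₁(ε·u)·Q₂(ε⁻¹·u)`, then `Q₁ = Q₂`. -/
theorem stmt_9 (l : ℕ) (hl : 1 ≤ l) (ε : ℂ) (hε0 : ε ≠ 0)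
    (hε : IsPrimitiveRoot (ε ^ 2) l)
    (Q₁ Q₂ : ℂ[X]) (h₁ : Q₁.eval 0 = 1) (h₂ : Q₂.eval 0 = 1)
    (hac₁ : ∀ a : ℂ, a ≠ 0 → ¬ ((1 - C a * X ^ l) ∣ Q₁))
    (hac₂ : ∀ a : ℂ, a ≠ 0 → ¬ ((1 - C a * X ^ l) ∣ Q₂))
    (h : Q₁.comp (C ε⁻¹ * X) * Q₂.comp (C ε * X) =
         Q₁.comp (C ε * X) * Q₂.comp (C ε⁻¹ * X)) :
    Q₁ = Q₂ := by
  have hl0 : l ≠ 0 := by omega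
  have hq : ε ^ 2 ≠ 0 := pow_ne_zero 2 hε0
  have hinv : (C ε⁻¹ * X : ℂ[X]).comp (C ε * X) = X := by
    rw [mul_comp, C_comp, X_comp, ← mul_assoc, ← C_mul, inv_mul_cancel₀ hε0, C_1, one_mul]
  have hsq : (C ε * X : ℂ[X]).comp (C ε * X) = C (ε ^ 2) * X := by
    rw [mul_comp, C_comp, X_comp, ← mul_assoc, ← C_mul, sq]
  have hcomp := congrArg (fun P : ℂ[X] => P.comp (C ε * X)) h
  beta_reduce at hcomp
  rw [mul_comp (Q₁.comp _), mul_comp (Q₁.comp _)] at hcomp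
  simp only [comp_assoc] at hcomp
  rw [hinv, hsq, comp_X, comp_X] at hcomp
  have hQ₁ : Q₁ ≠ 0 := by
    rintro rfl
    simp at h₁
  obtain ⟨G, A, B, hAB, rfl, rfl⟩ :
      ∃ G A B : ℂ[X], IsCoprime A B ∧ Q₁ = G * A ∧ Q₂ = G * B := by
    have hg : EuclideanDomain.gcd Q₁ Q₂ ≠ 0 := fun h0 =>
      hQ₁ (EuclideanDomain.gcd_eq_zero_iff.mp h0).1
    obtain ⟨A, hA⟩ := EuclideanDomain.gcd_dvd_left Q₁ Q₂
    obtain ⟨B, hB⟩ := EuclideanDomain.gcd_dvd_right Q₁ Q₂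
    refine ⟨_, A, B, ⟨EuclideanDomain.gcdA Q₁ Q₂, EuclideanDomain.gcdB Q₁ Q₂, ?_⟩, hA, hB⟩
    apply mul_left_cancel₀ hg
    linear_combination -EuclideanDomain.gcd_eq_gcd_ab Q₁ Q₂ -
      EuclideanDomain.gcdA Q₁ Q₂ * hA - EuclideanDomain.gcdB Q₁ Q₂ * hB
  have hG : G ≠ 0 := left_ne_zero_of_mul hQ₁
  have hGq : G.comp (C (ε ^ 2) * X) ≠ 0 := by
    intro h0
    have h0' := congrArg (eval 0) h0
    rw [eval_mul] at h₁
    have hG0 : G.eval 0 = 0 := by simpa [eval_comp] using h0'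
    simp [hG0] at h₁
  have key : A * B.comp (C (ε ^ 2) * X) = A.comp (C (ε ^ 2) * X) * B := by
    rw [mul_comp, mul_comp] at hcomp
    apply mul_left_cancel₀ (mul_ne_zero hG hGq)
    linear_combination hcomp
  rw [eval_mul] at h₁ h₂
  have hA0 : A.eval 0 ≠ 0 := right_ne_zero_of_mul (h₁.trans_ne one_ne_zero)
  have hB0 : B.eval 0 ≠ 0 := right_ne_zero_of_mul (h₂.trans_ne one_ne_zero)
  have hAq := comp_C_mul_X_eq_self_of_dvd hq hA0 (hAB.dvd_of_dvd_mul_right ⟨_, key.symm⟩)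
  have hBq := comp_C_mul_X_eq_self_of_dvd hq hB0
    (hAB.symm.dvd_of_dvd_mul_left ⟨A.comp (C (ε ^ 2) * X), by rw [key, mul_comm]⟩)
  have hAC := eq_C_of_comp_C_mul_X_eq hl0 hε hA0 hAq
    fun a ha hd => hac₁ a ha (dvd_mul_of_dvd_right hd G)
  have hBC := eq_C_of_comp_C_mul_X_eq hl0 hε hB0 hBq
    fun a ha hd => hac₂ a ha (dvd_mul_of_dvd_right hd G)
  have hG0 : G.eval 0 ≠ 0 := left_ne_zero_of_mul (h₁.trans_ne one_ne_zero)
  rw [hAC, hBC, mul_left_cancel₀ hG0 (h₁.trans h₂.symm)]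
end
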